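/- Assume the gradients of the non-faulty costs q^i (i ∈ H) are L-Lipschitz, the average non-faulty cost q^H is μ-strongly convex with 0 < μ ≤ L and unique minimizer x*_H, ∇q^i(x*_H) = 0 for every i ∈ H, and f/(N−f) ≤ μ/(3L). Let T ≥ 1 and 0 < α ≤ μ/(16 T L²). For any x̄ ∈ ℝ^d, suppose each non-faulty agent i ∈ H submits v_i = x^i_T, where x^i_0 = x̄ and x^i_{t+1} = x^i_t − α∇q^i(x^i_t) for t = 0,…,T−1; each faulty agent j ∉ H submits an arbitrary vector v_j ∈ ℝ^d; F ⊆ {1,…,N} with |F| = N − f satisfies ‖x̄ − v_j‖ ≤ ‖x̄ − v_l‖ for all j ∈ F and l ∉ F; and x̄' = (1/(N−f)) Σ_{i∈F} v_i. Then ‖x̄' − x*_H‖² ≤ (1 − μTα/6) ‖x̄ − x*_H‖². -/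

import Mathlib

open scoped RealInnerProductSpace

section LocalDescent

variable {E : Type*} [NormedAddCommGroup E] [InnerProductSpace ℝ E]

/-- Drift of gradient descent from its starting point, for small total step size. -/
lemma norm_gd_iterate_sub_start_le {G : E → E} {L α : ℝ} {T : ℕ} {x : ℕ → E} {x₀ z : E}
    (hL : 0 ≤ L) (hα : 0 ≤ α) (hlip : ∀ x y, ‖G x - G y‖ ≤ L * ‖x - y‖) (hz : G z = 0)
    (hx0 : x 0 = x₀) (hx : ∀ t < T, x (t + 1) = x t - α • G (x t))
    (hstep : T * α * L ≤ 1 / 16) {s : ℕ} (hs : s ≤ T) :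
    ‖x s - x₀‖ ≤ 16 / 15 * (s * α * L) * ‖x₀ - z‖ := by
  induction s with
  | zero => simp [hx0]
  | succ s ih =>
    have ih := ih (by omega)
    have hsT : (s : ℝ) ≤ T := by exact_mod_cast (by omega : s ≤ T)
    have hs16 : s * α * L ≤ 1 / 16 := le_trans (by gcongr) hstep
    have hG : ‖G (x s)‖ ≤ L * (‖x s - x₀‖ + ‖x₀ - z‖) := by
      have h := hlip (x s) z
      rw [hz, sub_zero] at h
      exact h.trans (by gcongr; exact norm_sub_le_norm_sub_add_norm_sub _ _ _)
    have hdrift : ‖x s - x₀‖ ≤ 1 / 15 * ‖x₀ - z‖ := ih.trans (by gcongr; linarith)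
    calc ‖x (s + 1) - x₀‖ = ‖(x s - x₀) - α • G (x s)‖ := by
          rw [hx s (by omega)]; congr 1; abel
      _ ≤ ‖x s - x₀‖ + ‖α • G (x s)‖ := norm_sub_le _ _
      _ = ‖x s - x₀‖ + α * ‖G (x s)‖ := by rw [norm_smul, Real.norm_of_nonneg hα]
      _ ≤ 16 / 15 * (s * α * L) * ‖x₀ - z‖
            + α * (L * (1 / 15 * ‖x₀ - z‖ + ‖x₀ - z‖)) := by
          gcongr
          exact hG.trans (by gcongr)
      _ = 16 / 15 * ((s + 1 : ℕ) * α * L) * ‖x₀ - z‖ := by push_cast; ring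

/-- Several gradient descent steps are close to one long step from the starting point. -/
lemma norm_gd_iterate_sub_long_step_le {G : E → E} {L α : ℝ} {T : ℕ} {x : ℕ → E} {x₀ z : E}
    (hL : 0 ≤ L) (hα : 0 ≤ α) (hlip : ∀ x y, ‖G x - G y‖ ≤ L * ‖x - y‖) (hz : G z = 0)
    (hx0 : x 0 = x₀) (hx : ∀ t < T, x (t + 1) = x t - α • G (x t))
    (hstep : T * α * L ≤ 1 / 16) {s : ℕ} (hs : s ≤ T) :
    ‖x s - x₀ + (s * α) • G x₀‖ ≤ s * α * L * (16 / 15 * (T * α * L) * ‖x₀ - z‖) := by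
  induction s with
  | zero => simp [hx0]
  | succ s ih =>
    have ih := ih (by omega)
    have hsT : (s : ℝ) ≤ T := by exact_mod_cast (by omega : s ≤ T)
    have hdrift : ‖x s - x₀‖ ≤ 16 / 15 * (T * α * L) * ‖x₀ - z‖ :=
      (norm_gd_iterate_sub_start_le hL hα hlip hz hx0 hx hstep (by omega)).trans (by gcongr)
    calc ‖x (s + 1) - x₀ + ((s + 1 : ℕ) * α) • G x₀‖
        = ‖(x s - x₀ + (s * α) • G x₀) - α • (G (x s) - G x₀)‖ := by
          rw [hx s (by omega)]; congr 1; push_cast; module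
      _ ≤ ‖x s - x₀ + (s * α) • G x₀‖ + ‖α • (G (x s) - G x₀)‖ := norm_sub_le _ _
      _ = ‖x s - x₀ + (s * α) • G x₀‖ + α * ‖G (x s) - G x₀‖ := by
          rw [norm_smul, Real.norm_of_nonneg hα]
      _ ≤ s * α * L * (16 / 15 * (T * α * L) * ‖x₀ - z‖)
            + α * (L * (16 / 15 * (T * α * L) * ‖x₀ - z‖)) := by
          gcongr
          exact (hlip _ _).trans (by gcongr)
      _ = (s + 1 : ℕ) * α * L * (16 / 15 * (T * α * L) * ‖x₀ - z‖) := by push_cast; ring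

/-- One gradient step contracts towards a zero of a strongly monotone Lipschitz gradient. -/
lemma norm_sub_smul_le_of_inner_ge {w d : E} {η L μ : ℝ} (hη : 0 ≤ η)
    (hd : ‖d‖ ≤ L * ‖w‖) (hmono : μ * ‖w‖ ^ 2 ≤ ⟪w, d⟫) (hstep : (η * L) ^ 2 ≤ η * μ / 16)
    (hημ : η * μ ≤ 1) :
    ‖w - η • d‖ ≤ (1 - 31 / 32 * (η * μ)) * ‖w‖ := by
  have hb : 0 ≤ 1 - 31 / 32 * (η * μ) := by nlinarith [sq_nonneg (η * L)]
  refine le_of_sq_le_sq ?_ (by positivity)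
  rw [norm_sub_sq_real, norm_smul, Real.norm_of_nonneg hη, inner_smul_right]
  have h1 : (η * ‖d‖) ^ 2 ≤ η * μ / 16 * ‖w‖ ^ 2 :=
    calc (η * ‖d‖) ^ 2 ≤ (η * (L * ‖w‖)) ^ 2 := by gcongr
      _ = (η * L) ^ 2 * ‖w‖ ^ 2 := by ring
      _ ≤ _ := by gcongr
  have h2 := mul_le_mul_of_nonneg_left hmono hη
  nlinarith [sq_nonneg (31 / 32 * (η * μ) * ‖w‖)]

end LocalDescent

/-- Replacing a family of terms by equally many terms of smallest norm changes the sum by at most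
twice the number of replaced terms times a bound for the original ones. -/
lemma norm_sum_sub_sum_le_of_smallest {ι E : Type*} [DecidableEq ι] [SeminormedAddCommGroup E]
    {H F : Finset ι} {u : ι → E} {B : ℝ} (hcard : F.card = H.card)
    (hsel : ∀ j ∈ F, ∀ l ∉ F, ‖u j‖ ≤ ‖u l‖) (hB : ∀ i ∈ H, ‖u i‖ ≤ B) :
    ‖∑ i ∈ F, u i - ∑ i ∈ H, u i‖ ≤ 2 * (F \ H).card * B := by
  have hc : (F \ H).card = (H \ F).card := Finset.card_sdiff_comm hcard
  have h1 : ‖∑ i ∈ F \ H, u i‖ ≤ (F \ H).card * B := by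
    rw [← nsmul_eq_mul]
    refine (norm_sum_le _ _).trans (Finset.sum_le_card_nsmul _ _ _ fun j hj => ?_)
    obtain ⟨l, hl⟩ : (H \ F).Nonempty :=
      Finset.card_pos.1 (hc ▸ Finset.card_pos.2 ⟨j, hj⟩)
    rw [Finset.mem_sdiff] at hj hl
    exact (hsel j hj.1 l hl.2).trans (hB l hl.1)
  have h2 : ‖∑ i ∈ H \ F, u i‖ ≤ (F \ H).card * B := by
    rw [hc, ← nsmul_eq_mul]
    exact (norm_sum_le _ _).trans
      (Finset.sum_le_card_nsmul _ _ _ fun i hi => hB i (Finset.mem_sdiff.1 hi).1)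
  rw [← Finset.sum_sdiff_sub_sum_sdiff]
  refine (norm_sub_le _ _).trans ?_
  linarith

/-- **Single-iteration contraction of local GD with the CE filter (`T ≥ 1`, deterministic).**
Each non-faulty agent runs `T` local gradient-descent steps from `x̄` and submits the result;
faulty agents submit arbitrary vectors; the coordinator averages the `N - f` submissions
closest to `x̄`. The new estimate contracts towards `x*_H` at rate `1 - μTα/6`. -/
theorem ce_one_iteration_contraction_T
    (dim N f : ℕ)
    (H : Finset (Fin N)) (hHcard : H.card = N - f)
    (q : Fin N → EuclideanSpace ℝ (Fin dim) → ℝ)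
    (g : Fin N → EuclideanSpace ℝ (Fin dim) → EuclideanSpace ℝ (Fin dim))
    (L μ : ℝ) (hμ : 0 < μ) (hμL : μ ≤ L)
    (hgrad : ∀ i ∈ H, ∀ x, HasGradientAt (q i) (g i x) x)
    (hlip : ∀ i ∈ H, ∀ x y, ‖g i x - g i y‖ ≤ L * ‖x - y‖)
    (hsc : ∀ x y : EuclideanSpace ℝ (Fin dim),
      μ * ‖x - y‖ ^ 2 ≤ ⟪x - y, (H.card : ℝ)⁻¹ • ∑ i ∈ H, (g i x - g i y)⟫)
    (xstar : EuclideanSpace ℝ (Fin dim))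
    (hstar : ∀ i ∈ H, g i xstar = 0)
    (hratio : (f : ℝ) / ((N : ℝ) - f) ≤ μ / (3 * L))
    (T : ℕ) (hT : 1 ≤ T)
    (α : ℝ) (hα0 : 0 < α) (hα : α ≤ μ / (16 * T * L ^ 2))
    (xbar : EuclideanSpace ℝ (Fin dim))
    -- local iterates: `x^i_0 = x̄`, `x^i_{t+1} = x^i_t - α ∇q^i(x^i_t)`
    (xloc : Fin N → ℕ → EuclideanSpace ℝ (Fin dim))
    (hx0 : ∀ i ∈ H, xloc i 0 = xbar)
    (hxrec : ∀ i ∈ H, ∀ t < T, xloc i (t + 1) = xloc i t - α • g i (xloc i t))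
    -- non-faulty agents submit `x^i_T`; faulty agents submit arbitrary vectors
    (v : Fin N → EuclideanSpace ℝ (Fin dim))
    (hv : ∀ i ∈ H, v i = xloc i T)
    -- the CE filter keeps the `N - f` submissions closest to `x̄`
    (F : Finset (Fin N)) (hFcard : F.card = N - f)
    (hsel : ∀ j ∈ F, ∀ l ∉ F, ‖xbar - v j‖ ≤ ‖xbar - v l‖)
    (xbar' : EuclideanSpace ℝ (Fin dim))
    (hupd : xbar' = ((N : ℝ) - f)⁻¹ • ∑ i ∈ F, v i) :
    ‖xbar' - xstar‖ ^ 2 ≤ (1 - μ * T * α / 6) * ‖xbar - xstar‖ ^ 2 := by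
  rcases Nat.eq_zero_or_pos H.card with hH0 | hHpos
  · have hw : ‖xbar - xstar‖ = 0 := by
      have h := hsc xbar xstar
      rw [hH0, Nat.cast_zero, inv_zero, zero_smul, inner_zero_right] at h
      exact pow_eq_zero_iff two_ne_zero |>.1
        (le_antisymm (nonpos_of_mul_nonpos_right h hμ) (sq_nonneg _))
    have hw' : ‖xbar' - xstar‖ = 0 := by
      have h := hsc xbar' xstar
      rw [hH0, Nat.cast_zero, inv_zero, zero_smul, inner_zero_right] at h
      exact pow_eq_zero_iff two_ne_zero |>.1
        (le_antisymm (nonpos_of_mul_nonpos_right h hμ) (sq_nonneg _))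
    simp [hw, hw']
  have hfN : f < N := by omega
  have hn : (H.card : ℝ) = (N : ℝ) - f := by rw [hHcard, Nat.cast_sub hfN.le]
  rw [← hn] at hratio hupd
  have hnpos : (0 : ℝ) < H.card := by exact_mod_cast hHpos
  have hnne : (H.card : ℝ) ≠ 0 := hnpos.ne'
  have hL : 0 < L := hμ.trans_le hμL
  have hTpos : (0 : ℝ) < T := by exact_mod_cast hT
  set r := ‖xbar - xstar‖ with hr
  have hr0 : 0 ≤ r := norm_nonneg _
  set η : ℝ := T * α with hη
  have hη0 : 0 < η := mul_pos hTpos hα0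
  have hηL2 : η * L ^ 2 ≤ μ / 16 := by
    rw [le_div_iff₀ (by positivity)] at hα
    rw [hη]; linarith
  have hηL : η * L ≤ 1 / 16 := by
    have h : η * L * L ≤ 1 / 16 * L := by nlinarith
    exact le_of_mul_le_mul_right h hL
  have hημ : η * μ ≤ 1 / 16 := le_trans (by gcongr) hηL
  have hsq : (η * L) ^ 2 ≤ η * μ / 16 := by nlinarith
  have hdrift : ∀ i ∈ H, ‖v i - xbar‖ ≤ 16 / 15 * (η * L) * r := fun i hi => by
    rw [hv i hi]
    exact norm_gd_iterate_sub_start_le hL.le hα0.le (hlip i hi) (hstar i hi) (hx0 i hi)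
      (hxrec i hi) hηL le_rfl
  have herr : ∀ i ∈ H, ‖v i - xbar + η • g i xbar‖ ≤ η * μ / 15 * r := fun i hi => by
    rw [hv i hi]
    refine (norm_gd_iterate_sub_long_step_le hL.le hα0.le (hlip i hi) (hstar i hi) (hx0 i hi)
      (hxrec i hi) hηL le_rfl).trans ?_
    calc η * L * (16 / 15 * (η * L) * r) = (η * L) ^ 2 * (16 / 15 * r) := by ring
      _ ≤ η * μ / 16 * (16 / 15 * r) := by gcongr
      _ = η * μ / 15 * r := by ring
  have hfilter : ‖∑ i ∈ F, (v i - xbar) - ∑ i ∈ H, (v i - xbar)‖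
      ≤ 2 * f * (16 / 15 * (η * L) * r) := by
    refine (norm_sum_sub_sum_le_of_smallest (hFcard.trans hHcard.symm) (fun j hj l hl => ?_)
      hdrift).trans ?_
    · rw [norm_sub_rev, norm_sub_rev (v l)]
      exact hsel j hj l hl
    · have hle : (F \ H).card ≤ f := by
        calc (F \ H).card ≤ Hᶜ.card :=
              Finset.card_le_card fun i hi => Finset.mem_compl.2 (Finset.mem_sdiff.1 hi).2
          _ = f := by rw [Finset.card_compl, Fintype.card_fin]; omega
      gcongr
  set d := (H.card : ℝ)⁻¹ • ∑ i ∈ H, g i xbar with hd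
  have hmain : ‖(xbar - xstar) - η • d‖ ≤ (1 - 31 / 32 * (η * μ)) * r := by
    refine norm_sub_smul_le_of_inner_ge hη0.le ?_ ?_ hsq (by linarith)
    · rw [hd, norm_smul, norm_inv, Real.norm_of_nonneg hnpos.le, inv_mul_le_iff₀ hnpos,
        ← nsmul_eq_mul]
      refine (norm_sum_le _ _).trans (Finset.sum_le_card_nsmul _ _ _ fun i hi => ?_)
      simpa [hstar i hi] using hlip i hi xbar xstar
    · have h := hsc xbar xstar
      rwa [Finset.sum_congr rfl fun i hi => by rw [hstar i hi, sub_zero]] at h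
  have hdecomp : xbar' - xstar = ((xbar - xstar) - η • d)
      + (H.card : ℝ)⁻¹ • ∑ i ∈ H, (v i - xbar + η • g i xbar)
      + (H.card : ℝ)⁻¹ • (∑ i ∈ F, (v i - xbar) - ∑ i ∈ H, (v i - xbar)) := by
    have hF : (F.card : ℝ) = H.card := by rw [hFcard, hHcard]
    rw [hupd, hd, Finset.sum_add_distrib, ← Finset.smul_sum, Finset.sum_sub_distrib (s := F),
      Finset.sum_const, ← Nat.cast_smul_eq_nsmul ℝ, hF]
    simp only [smul_add, smul_sub, inv_smul_smul₀ hnne, smul_comm η]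
    abel
  have he : ‖(H.card : ℝ)⁻¹ • ∑ i ∈ H, (v i - xbar + η • g i xbar)‖ ≤ η * μ / 15 * r := by
    rw [norm_smul, norm_inv, Real.norm_of_nonneg hnpos.le, inv_mul_le_iff₀ hnpos,
      ← nsmul_eq_mul]
    exact (norm_sum_le _ _).trans (Finset.sum_le_card_nsmul _ _ _ herr)
  have hE : ‖(H.card : ℝ)⁻¹ • (∑ i ∈ F, (v i - xbar) - ∑ i ∈ H, (v i - xbar))‖
      ≤ 32 / 45 * (η * μ) * r := by
    rw [norm_smul, norm_inv, Real.norm_of_nonneg hnpos.le]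
    calc (H.card : ℝ)⁻¹ * _ ≤ (H.card : ℝ)⁻¹ * (2 * f * (16 / 15 * (η * L) * r)) := by gcongr
      _ = f / H.card * (32 / 15 * (η * L) * r) := by ring
      _ ≤ μ / (3 * L) * (32 / 15 * (η * L) * r) := by gcongr
      _ = 32 / 45 * (η * μ) * r := by field_simp; ring
  have hb0 : 0 < η * μ := mul_pos hη0 hμ
  have hfinal : ‖xbar' - xstar‖ ≤ (1 - η * μ / 6) * r := by
    rw [hdecomp]
    refine (norm_add₃_le).trans ?_
    nlinarith [mul_nonneg hb0.le hr0]
  have hrate : 1 - μ * T * α / 6 = 1 - η * μ / 6 := by rw [hη]; ring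
  rw [hrate]
  calc ‖xbar' - xstar‖ ^ 2 ≤ ((1 - η * μ / 6) * r) ^ 2 := by gcongr
    _ = (1 - η * μ / 6) * ((1 - η * μ / 6) * r ^ 2) := by ring
    _ ≤ (1 - η * μ / 6) * (1 * r ^ 2) := by
      have : 0 ≤ 1 - η * μ / 6 := by linarith
      gcongr
      linarith
    _ = (1 - η * μ / 6) * r ^ 2 := by ring
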